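/- For every k ∈ ℕ and every 1 ≤ p ≤ ∞, the L^p norm of W(k) on [0,1) satisfies ‖W(k)‖_{L^p} ≤ 2^{1 − 1/p}. -/

import Mathlib

open MeasureTheory Finset
open scoped ENNReal

noncomputable section

/-- The `j`-th binary digit (`j ≥ 1`) of a real number `x ∈ [0,1)`
(using the binary expansion in which infinitely many digits are `0`). -/
def bdigit (x : ℝ) (j : ℕ) : ℕ := ⌊x * 2 ^ j⌋.toNat % 2

/-- The `k`-th (dyadic) Walsh function. -/
def walsh (k : ℕ) (x : ℝ) : ℝ :=
  (-1 : ℝ) ^ (∑ j ∈ Finset.range k, if k.testBit j then bdigit x (j + 1) else 0)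

/-- The multi-dimensional Walsh function. -/
def walshV {s : ℕ} (k : Fin s → ℕ) (x : Fin s → ℝ) : ℝ := ∏ i, walsh (k i) (x i)

/-- The half-open unit cube `[0,1)^s`. -/
def unitCube (s : ℕ) : Set (Fin s → ℝ) := Set.univ.pi fun _ => Set.Ico (0 : ℝ) 1

/-- The closed unit cube `[0,1]^s`. -/
def closedCube (s : ℕ) : Set (Fin s → ℝ) := Set.univ.pi fun _ => Set.Icc (0 : ℝ) 1

/-- The `k`-th Walsh coefficient of `f`. -/
def walshCoeff {s : ℕ} (f : (Fin s → ℝ) → ℝ) (k : Fin s → ℕ) : ℝ :=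
  ∫ x in unitCube s, f x * walshV k x

/-- `z ⊕ 2^{-n}` : flipping the `n`-th binary digit of `z`. -/
def oplus (z : ℝ) (n : ℕ) : ℝ := z + (-1) ^ bdigit z n * ((2 : ℝ) ^ n)⁻¹

/-- The dyadic difference `∂_{i,n}`. -/
def dyadicDiff {s : ℕ} (i : Fin s) (n : ℕ) (g : (Fin s → ℝ) → ℝ) (x : Fin s → ℝ) : ℝ :=
  2 ^ n * (g (Function.update x i (oplus (x i) n)) - g x)

/-- The function `χ_n`. -/
def chi (n : ℕ) (x y : ℝ) : ℝ :=
  if min x (oplus x n) ≤ y ∧ y ≤ max x (oplus x n) then 2 ^ n else 0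

/-- The exponents in the binary expansion of `k`, in decreasing order. -/
def bitsDesc (k : ℕ) : List ℕ := ((List.range k).filter fun j => k.testBit j).reverse

/-- The number `N` of nonzero binary digits of `k`. -/
def numBits (k : ℕ) : ℕ := (bitsDesc k).length

/-- The weight `μ'_u(k) = ∑_{j=1}^{min(u,N)} (a_j + 2)` for scalar `k`. -/
def muW (u k : ℕ) : ℕ := (((bitsDesc k).take u).map (· + 2)).sum

/-- The weight `μ'_u(k)` for vectors. -/
def muWV {s : ℕ} (u k : Fin s → ℕ) : ℕ := ∑ i, muW (u i) (k i)

/-- `k_{≤}^{u}` : the `u` most significant binary digits of `k`. -/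
def kLe (u k : ℕ) : ℕ := (((bitsDesc k).take u).map (2 ^ ·)).sum

/-- `k_{>}^{u}` : the remaining binary digits of `k`. -/
def kGt (u k : ℕ) : ℕ := (((bitsDesc k).drop u).map (2 ^ ·)).sum

/-- The functions `W(k)`, defined inductively by stripping the least significant
binary digit of `k` (whose exponent is the 2-adic valuation of `k`). -/
def Wfun : ℕ → ℝ → ℝ
  | 0 => fun _ => 1
  | (k + 1) => fun y =>
      ∫ x in Set.Ico (0 : ℝ) 1,
        chi ((k + 1).factorization 2 + 1) x y *
          Wfun ((k + 1) - 2 ^ ((k + 1).factorization 2)) x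
  decreasing_by exact Nat.sub_lt (Nat.succ_pos k) (Nat.two_pow_pos _)

/-- Composition of the dyadic differences `∂_{i,a+1}` for `a` running over a list. -/
def dCompCoord {s : ℕ} (i : Fin s) (L : List ℕ) (g : (Fin s → ℝ) → ℝ) : (Fin s → ℝ) → ℝ :=
  L.foldr (fun a h => dyadicDiff i (a + 1) h) g

/-- The operator `d_{k_u}` : composition over all coordinates `i` of the dyadic
differences `∂_{i,a_{i,j}+1}`, `1 ≤ j ≤ min(u_i, N_i)`. -/
def dComp {s : ℕ} (u k : Fin s → ℕ) (f : (Fin s → ℝ) → ℝ) : (Fin s → ℝ) → ℝ :=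
  (List.finRange s).foldr (fun i g => dCompCoord i ((bitsDesc (k i)).take (u i)) g) f

/-- The multi-index `ν` increased by one in coordinate `i`. -/
def addE {s : ℕ} (i : Fin s) (ν : Fin s → ℕ) : Fin s → ℕ := Function.update ν i (ν i + 1)

/-- `D` is a family of mixed partial derivatives of `f`, of orders up to `u_i` in
the variable `x_i`, each continuous on the closed cube `[0,1]^s`. -/
def HasMixedDerivs {s : ℕ} (u : Fin s → ℕ) (f : (Fin s → ℝ) → ℝ)
    (D : (Fin s → ℕ) → (Fin s → ℝ) → ℝ) : Prop :=
  D (fun _ => 0) = f ∧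
    (∀ ν : Fin s → ℕ, (∀ j, ν j ≤ u j) → ContinuousOn (D ν) (closedCube s)) ∧
    ∀ (ν : Fin s → ℕ) (i : Fin s), (∀ j, addE i ν j ≤ u j) →
      ∀ x ∈ closedCube s,
        HasDerivWithinAt (fun t => D ν (Function.update x i t)) (D (addE i ν) x)
          (Set.Icc 0 1) (x i)

/-- `∫_{[0,1)^{s-|v|}} F dx_{S∖v}` : the inner integral over the coordinates outside `v`
(as a function of the coordinates in `v`). -/
def projInt {s : ℕ} (v : Finset (Fin s)) (F : (Fin s → ℝ) → ℝ) (x : Fin s → ℝ) : ℝ :=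
  ∫ y in unitCube s, F fun i => if i ∈ v then x i else y i

/-- The mixed norm `‖F^{(·)}‖_p` : the `L^p` norm (over the coordinates in `v`) of the
integral of `F` over the coordinates outside `v`. -/
def mixedNorm {s : ℕ} (p : ℝ≥0∞) (v : Finset (Fin s)) (F : (Fin s → ℝ) → ℝ) : ℝ≥0∞ :=
  eLpNorm (projInt v F) p (volume.restrict (unitCube s))

/-- The `ℓ^q` norm of a finite family in `ℝ≥0∞`, with the usual modification at `q = ∞`. -/
def lqNorm {ι : Type*} [Fintype ι] (q : ℝ≥0∞) (a : ι → ℝ≥0∞) : ℝ≥0∞ :=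
  if q = ∞ then ⨆ i, a i else (∑ i, a i ^ q.toReal) ^ q.toReal⁻¹

/-- The `h`-th point of the digital net generated by the matrices `C i`. -/
def netPoint {s m n : ℕ} (C : Fin s → Matrix (Fin n) (Fin m) (ZMod 2)) (h : Fin (2 ^ m)) :
    Fin s → ℝ :=
  fun i => ∑ j : Fin n,
    (((∑ l : Fin m, (if (h : ℕ).testBit (l : ℕ) then (1 : ZMod 2) else 0) * C i j l).val : ℝ) *
      ((2 : ℝ) ^ ((j : ℕ) + 1))⁻¹)

/-- Membership of `k ∈ ℕ₀^s` in the dual net `P^⊥`. -/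
def inDual {s m n : ℕ} (C : Fin s → Matrix (Fin n) (Fin m) (ZMod 2)) (k : Fin s → ℕ) : Prop :=
  ∀ l : Fin m, ∑ i, ∑ j : Fin n, C i j l * (if (k i).testBit (j : ℕ) then (1 : ZMod 2) else 0) = 0

open Classical in
/-- `∑_{k_v ∈ P_v^⊥} 2^{-μ'_α(k_v)}`, encoded as a sum over all `k ∈ ℕ₀^s`
with support exactly `v` lying in the dual net. -/
def dualSum {s m n : ℕ} (α : ℕ) (C : Fin s → Matrix (Fin n) (Fin m) (ZMod 2))
    (v : Finset (Fin s)) : ℝ≥0∞ :=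
  ∑' k : Fin s → ℕ,
    if (∀ i, i ∈ v ↔ k i ≠ 0) ∧ inDual C k
    then (2 : ℝ≥0∞) ^ (-(muWV (fun _ => α) k : ℝ)) else 0


lemma Wfun_of_ne_zero {k : ℕ} (hk : k ≠ 0) (y : ℝ) :
    Wfun k y = ∫ x in Set.Ico (0 : ℝ) 1,
      chi (k.factorization 2 + 1) x y * Wfun (k - 2 ^ k.factorization 2) x := by
  obtain ⟨k, rfl⟩ := Nat.exists_eq_succ_of_ne_zero hk
  rw [Nat.succ_eq_add_one, Wfun]

lemma measurable_bdigit (n : ℕ) : Measurable fun x => bdigit x n := by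
  unfold bdigit
  exact (measurable_from_top (f := fun z : ℤ => z.toNat % 2)).comp
    (Int.measurable_floor.comp (measurable_id.mul_const _))

lemma measurable_oplus (n : ℕ) : Measurable fun x => oplus x n := by
  unfold oplus
  have h : Measurable fun x => ((-1 : ℝ)) ^ bdigit x n :=
    (measurable_from_top (f := fun m : ℕ => (-1 : ℝ) ^ m)).comp (measurable_bdigit n)
  exact measurable_id.add (h.mul_const _)

lemma measurable_chi (n : ℕ) : Measurable fun z : ℝ × ℝ => chi n z.1 z.2 := by
  unfold chi
  have h : Measurable fun z : ℝ × ℝ => oplus z.1 n := (measurable_oplus n).comp measurable_fst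
  refine Measurable.ite ?_ measurable_const measurable_const
  exact (measurableSet_le (measurable_fst.min h) measurable_snd).inter
    (measurableSet_le measurable_snd (measurable_fst.max h))

lemma measurable_Wfun (k : ℕ) : Measurable (Wfun k) := by
  induction k using Nat.strong_induction_on with
  | _ k ih =>
    rcases eq_or_ne k 0 with rfl | hk
    · rw [Wfun]; exact measurable_const
    · have h := ih (k - 2 ^ k.factorization 2)
        (Nat.sub_lt (Nat.pos_of_ne_zero hk) (Nat.two_pow_pos _))
      have hm : Measurable fun z : ℝ × ℝ => chi (k.factorization 2 + 1) z.2 z.1 *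
          Wfun (k - 2 ^ k.factorization 2) z.2 :=
        ((measurable_chi _).comp measurable_swap).mul (h.comp measurable_snd)
      rw [show Wfun k = _ from funext (Wfun_of_ne_zero hk)]
      exact (hm.stronglyMeasurable.integral_prod_right
        (ν := volume.restrict (Set.Ico (0 : ℝ) 1))).measurable

lemma oplus_of_even {x : ℝ} {n : ℕ} (h : ⌊x * 2 ^ n⌋₊ % 2 = 0) :
    oplus x n = x + ((2 : ℝ) ^ n)⁻¹ := by
  simp [oplus, bdigit, Int.floor_toNat, h]

lemma oplus_of_odd {x : ℝ} {n : ℕ} (h : ⌊x * 2 ^ n⌋₊ % 2 = 1) :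
    oplus x n = x - ((2 : ℝ) ^ n)⁻¹ := by
  simp [oplus, bdigit, Int.floor_toNat, h, sub_eq_add_neg]

/-- The function `χ_{v+1}` vanishes off the diagonal dyadic squares of side `2^{-v}`. -/
lemma floor_eq_of_chi_ne_zero {v : ℕ} {x y : ℝ} (hx : 0 ≤ x) (h : chi (v + 1) x y ≠ 0) :
    ⌊y * 2 ^ v⌋₊ = ⌊x * 2 ^ v⌋₊ := by
  unfold chi at h
  obtain ⟨h1, h2⟩ : min x (oplus x (v + 1)) ≤ y ∧ y ≤ max x (oplus x (v + 1)) := by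
    by_contra hc; exact h (if_neg hc)
  set q := ⌊x * 2 ^ (v + 1)⌋₊ with hq
  have hp : (0 : ℝ) < 2 ^ v := by positivity
  have hq1 : (q : ℝ) ≤ x * 2 ^ (v + 1) := Nat.floor_le (by positivity)
  have hq2 : x * 2 ^ (v + 1) < q + 1 := Nat.lt_floor_add_one _
  rw [pow_succ] at hq1 hq2
  have hd : (q : ℝ) = 2 * (q / 2 : ℕ) + (q % 2 : ℕ) := by exact_mod_cast (Nat.div_add_mod q 2).symm
  have hi : ((2 : ℝ) ^ (v + 1))⁻¹ * 2 ^ v = 1 / 2 := by rw [pow_succ]; field_simp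
  have hi0 : (0 : ℝ) ≤ ((2 : ℝ) ^ (v + 1))⁻¹ := by positivity
  have key : ((q / 2 : ℕ) : ℝ) ≤ y * 2 ^ v ∧ y * 2 ^ v < (q / 2 : ℕ) + 1 := by
    rcases Nat.mod_two_eq_zero_or_one q with hb | hb
    · rw [oplus_of_even hb, min_eq_left (by linarith)] at h1
      rw [oplus_of_even hb, max_eq_right (by linarith)] at h2
      have h1' := mul_le_mul_of_nonneg_right h1 hp.le
      have h2' := mul_le_mul_of_nonneg_right h2 hp.le
      rw [hb] at hd
      push_cast at hd
      constructor <;> linarith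
    · rw [oplus_of_odd hb, min_eq_right (by linarith)] at h1
      rw [oplus_of_odd hb, max_eq_left (by linarith)] at h2
      have h1' := mul_le_mul_of_nonneg_right h1 hp.le
      have h2' := mul_le_mul_of_nonneg_right h2 hp.le
      rw [hb] at hd
      push_cast at hd
      constructor <;> linarith
  have hr : ((q % 2 : ℕ) : ℝ) ≤ 1 := by exact_mod_cast Nat.le_of_lt_succ (Nat.mod_lt q two_pos)
  have hr0 : (0 : ℝ) ≤ ((q % 2 : ℕ) : ℝ) := Nat.cast_nonneg _
  have hn : (0 : ℝ) ≤ ((q / 2 : ℕ) : ℝ) := Nat.cast_nonneg _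
  rw [(Nat.floor_eq_iff (hn.trans key.1)).2 key,
    (Nat.floor_eq_iff (n := q / 2) (by positivity)).2 ⟨by linarith, by linarith⟩]

lemma floor_mul_two_pow_congr {j v : ℕ} (hj : j ≤ v) {x y : ℝ}
    (h : ⌊y * 2 ^ v⌋₊ = ⌊x * 2 ^ v⌋₊) : ⌊y * 2 ^ j⌋₊ = ⌊x * 2 ^ j⌋₊ := by
  have aux (z : ℝ) : ⌊z * 2 ^ j⌋₊ = ⌊z * 2 ^ v⌋₊ / 2 ^ (v - j) := by
    rw [← Nat.floor_div_natCast]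
    congr 1
    obtain ⟨d, rfl⟩ := Nat.exists_eq_add_of_le hj
    simp only [Nat.add_sub_cancel_left, pow_add]
    push_cast
    field_simp
  rw [aux, aux, h]

/-- The dyadic interval of length `2^{-j}` and index `m`, intersected with `[0,1)`. -/
def dyadicCell (j m : ℕ) : Set ℝ := {x | x ∈ Set.Ico (0 : ℝ) 1 ∧ ⌊x * 2 ^ j⌋₊ = m}

lemma measurableSet_dyadicCell (j m : ℕ) : MeasurableSet (dyadicCell j m) :=
  measurableSet_Ico.inter
    ((Nat.measurable_floor.comp (measurable_id.mul_const _)) (measurableSet_singleton m))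

lemma volume_dyadicCell_le (j m : ℕ) : volume (dyadicCell j m) ≤ (2 ^ j)⁻¹ := by
  have hs : dyadicCell j m ⊆ Set.Ico ((m : ℝ) / 2 ^ j) ((m + 1) / 2 ^ j) := by
    rintro x ⟨hx, rfl⟩
    have hx0 := hx.1
    constructor
    · rw [div_le_iff₀ (by positivity)]
      exact Nat.floor_le (by positivity)
    · rw [lt_div_iff₀ (by positivity)]
      exact Nat.lt_floor_add_one _
  refine (measure_mono hs).trans ?_
  rw [Real.volume_Ico, ← sub_div, add_sub_cancel_left, one_div,
    ENNReal.ofReal_inv_of_pos (by positivity), ENNReal.ofReal_pow (by norm_num)]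
  simp

lemma enorm_chi_le (n : ℕ) (x y : ℝ) : ‖chi n x y‖ₑ ≤ 2 ^ n := by
  unfold chi
  split_ifs
  · rw [enorm_pow, Real.enorm_eq_ofReal (by norm_num)]; simp
  · simp

lemma lintegral_enorm_chi_le (n : ℕ) (x : ℝ) : ∫⁻ y, ‖chi n x y‖ₑ ≤ 1 := by
  have h : (fun y => ‖chi n x y‖ₑ) ≤ (Set.Icc (min x (oplus x n)) (max x (oplus x n))).indicator
      fun _ => (2 : ℝ≥0∞) ^ n := by
    intro y
    by_cases hy : y ∈ Set.Icc (min x (oplus x n)) (max x (oplus x n))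
    · rw [Set.indicator_of_mem hy]; exact enorm_chi_le n x y
    · have : chi n x y = 0 := if_neg hy
      simp [this]
  refine (lintegral_mono h).trans ?_
  rw [lintegral_indicator_const measurableSet_Icc, Real.volume_Icc, max_sub_min_eq_abs]
  have : |oplus x n - x| = ((2 : ℝ) ^ n)⁻¹ := by simp [oplus, abs_mul]
  rw [this, ENNReal.ofReal_inv_of_pos (by positivity), ENNReal.ofReal_pow (by norm_num)]
  simp [ENNReal.mul_inv_cancel]

lemma enorm_Wfun_le_lintegral {k : ℕ} (hk : k ≠ 0) (y : ℝ) :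
    ‖Wfun k y‖ₑ ≤ ∫⁻ x in Set.Ico (0 : ℝ) 1, ‖chi (k.factorization 2 + 1) x y‖ₑ *
      ‖Wfun (k - 2 ^ k.factorization 2) x‖ₑ := by
  rw [Wfun_of_ne_zero hk]
  refine (enorm_integral_le_lintegral_enorm _).trans_eq ?_
  simp only [enorm_mul]

/-- If `2^j` divides `k`, then `W(k)` has mass at most `2^{-j}` on dyadic intervals of
length `2^{-j}`. -/
lemma lintegral_enorm_Wfun_dyadicCell_le {k j : ℕ} (hj : 2 ^ j ∣ k) (m : ℕ) :
    ∫⁻ x in dyadicCell j m, ‖Wfun k x‖ₑ ≤ (2 ^ j)⁻¹ := by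
  induction k using Nat.strong_induction_on with
  | _ k ih =>
    rcases eq_or_ne k 0 with rfl | hk
    · rw [Wfun]
      simpa using volume_dyadicCell_le j m
    set v := k.factorization 2 with hv
    have hjv : j ≤ v := (Nat.prime_two.pow_dvd_iff_le_factorization hk).1 hj
    have hS := measurableSet_dyadicCell j m
    have hmeas : Measurable fun z : ℝ × ℝ => ‖chi (v + 1) z.2 z.1‖ₑ * ‖Wfun (k - 2 ^ v) z.2‖ₑ :=
      ((measurable_chi _).comp measurable_swap).enorm.mul
        ((measurable_Wfun _).comp measurable_snd).enorm
    calc ∫⁻ y in dyadicCell j m, ‖Wfun k y‖ₑ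
        ≤ ∫⁻ y in dyadicCell j m, ∫⁻ x in Set.Ico (0 : ℝ) 1,
            ‖chi (v + 1) x y‖ₑ * ‖Wfun (k - 2 ^ v) x‖ₑ :=
          lintegral_mono fun y => enorm_Wfun_le_lintegral hk y
      _ = ∫⁻ x in Set.Ico (0 : ℝ) 1, ∫⁻ y in dyadicCell j m,
            ‖chi (v + 1) x y‖ₑ * ‖Wfun (k - 2 ^ v) x‖ₑ :=
          lintegral_lintegral_swap hmeas.aemeasurable
      _ ≤ ∫⁻ x in Set.Ico (0 : ℝ) 1,
            (dyadicCell j m).indicator (fun x => ‖Wfun (k - 2 ^ v) x‖ₑ) x := by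
          refine setLIntegral_mono' measurableSet_Ico fun x hx => ?_
          have hchi : Measurable fun y => ‖chi (v + 1) x y‖ₑ :=
            ((measurable_chi _).comp measurable_prodMk_left).enorm
          rw [lintegral_mul_const _ hchi]
          by_cases hxS : x ∈ dyadicCell j m
          · rw [Set.indicator_of_mem hxS]
            exact mul_le_of_le_one_left' ((setLIntegral_le_lintegral _ _).trans
              (lintegral_enorm_chi_le _ _))
          · rw [Set.indicator_of_notMem hxS]
            have : ∫⁻ y in dyadicCell j m, ‖chi (v + 1) x y‖ₑ = 0 := by
              refine (setLIntegral_congr_fun hS fun y hy => ?_).trans (lintegral_zero)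
              by_contra hc
              refine hxS ⟨hx, ?_⟩
              rw [← floor_mul_two_pow_congr hjv
                (floor_eq_of_chi_ne_zero hx.1 (enorm_ne_zero.1 hc)), hy.2]
            rw [this, zero_mul]
      _ ≤ ∫⁻ x in dyadicCell j m, ‖Wfun (k - 2 ^ v) x‖ₑ := by
          rw [← lintegral_indicator hS]
          exact setLIntegral_le_lintegral _ _
      _ ≤ (2 ^ j)⁻¹ := ih _ (Nat.sub_lt (Nat.pos_of_ne_zero hk) (Nat.two_pow_pos _))
          (Nat.dvd_sub hj (pow_dvd_pow 2 hjv))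

lemma enorm_Wfun_le_two {k : ℕ} (hk : k ≠ 0) (y : ℝ) : ‖Wfun k y‖ₑ ≤ 2 := by
  set v := k.factorization 2 with hv
  have hS := measurableSet_dyadicCell v ⌊y * 2 ^ v⌋₊
  have hdvd : 2 ^ v ∣ k - 2 ^ v := Nat.dvd_sub (Nat.ordProj_dvd k 2) dvd_rfl
  calc ‖Wfun k y‖ₑ
      ≤ ∫⁻ x in Set.Ico (0 : ℝ) 1, ‖chi (v + 1) x y‖ₑ * ‖Wfun (k - 2 ^ v) x‖ₑ :=
        enorm_Wfun_le_lintegral hk y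
    _ ≤ ∫⁻ x in Set.Ico (0 : ℝ) 1, (dyadicCell v ⌊y * 2 ^ v⌋₊).indicator
          (fun x => 2 ^ (v + 1) * ‖Wfun (k - 2 ^ v) x‖ₑ) x := by
        refine setLIntegral_mono' measurableSet_Ico fun x hx => ?_
        by_cases hxS : x ∈ dyadicCell v ⌊y * 2 ^ v⌋₊
        · rw [Set.indicator_of_mem hxS]
          gcongr
          exact enorm_chi_le _ _ _
        · have : chi (v + 1) x y = 0 := by
            by_contra hc
            exact hxS ⟨hx, (floor_eq_of_chi_ne_zero hx.1 hc).symm⟩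
          simp [this]
    _ ≤ ∫⁻ x in dyadicCell v ⌊y * 2 ^ v⌋₊, 2 ^ (v + 1) * ‖Wfun (k - 2 ^ v) x‖ₑ := by
        rw [← lintegral_indicator hS]
        exact setLIntegral_le_lintegral _ _
    _ ≤ 2 ^ (v + 1) * (2 ^ v)⁻¹ := by
        rw [lintegral_const_mul _ (measurable_Wfun _).enorm]
        gcongr
        exact lintegral_enorm_Wfun_dyadicCell_le hdvd _
    _ = 2 := by
        rw [pow_succ, mul_comm (2 ^ v), mul_assoc, ENNReal.mul_inv_cancel (by simp) (by simp),
          mul_one]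

lemma lintegral_enorm_Wfun_le_one (k : ℕ) :
    ∫⁻ x in Set.Ico (0 : ℝ) 1, ‖Wfun k x‖ₑ ≤ 1 := by
  have hcell : dyadicCell 0 0 = Set.Ico (0 : ℝ) 1 := by
    ext x
    simp +contextual [dyadicCell, Nat.floor_eq_zero]
  simpa [hcell] using lintegral_enorm_Wfun_dyadicCell_le (k := k) (j := 0) (by simp) 0

/-- Interpolation between an `L¹` and an `L^∞` bound. -/
lemma eLpNorm_le_rpow_of_enorm_le {α : Type*} [MeasurableSpace α] {μ : Measure α} {f : α → ℝ}
    {C : ℝ≥0∞} (hC : C ≠ ∞) (hf : ∀ x, ‖f x‖ₑ ≤ C) (h1 : ∫⁻ x, ‖f x‖ₑ ∂μ ≤ 1)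
    {p : ℝ≥0∞} (hp : 1 ≤ p) : eLpNorm f p μ ≤ C ^ ((1 : ℝ) - p.toReal⁻¹) := by
  rcases eq_or_ne p ∞ with rfl | hp_top
  · simpa using eLpNormEssSup_le_of_ae_enorm_bound (Filter.Eventually.of_forall hf)
  have hr : 1 ≤ p.toReal := by
    simpa using (ENNReal.toReal_le_toReal ENNReal.one_ne_top hp_top).2 hp
  have hp0 : p ≠ 0 := (zero_lt_one.trans_le hp).ne'
  rw [eLpNorm_eq_lintegral_rpow_enorm_toReal hp0 hp_top]
  have hexp : (1 : ℝ) - p.toReal⁻¹ = (p.toReal - 1) * (1 / p.toReal) := by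
    field_simp
  rw [hexp, ENNReal.rpow_mul]
  refine ENNReal.rpow_le_rpow ?_ (by positivity)
  calc ∫⁻ x, ‖f x‖ₑ ^ p.toReal ∂μ
      ≤ ∫⁻ x, C ^ (p.toReal - 1) * ‖f x‖ₑ ∂μ := by
        refine lintegral_mono fun x => ?_
        calc ‖f x‖ₑ ^ p.toReal = ‖f x‖ₑ ^ (p.toReal - 1) * ‖f x‖ₑ := by
              conv_lhs => rw [← sub_add_cancel p.toReal 1]
              rw [ENNReal.rpow_add_of_nonneg _ _ (by linarith) zero_le_one, ENNReal.rpow_one]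
          _ ≤ _ := by
              gcongr
              exact hf x
    _ = C ^ (p.toReal - 1) * ∫⁻ x, ‖f x‖ₑ ∂μ :=
        lintegral_const_mul' _ _ (ENNReal.rpow_ne_top_of_nonneg (by linarith) hC)
    _ ≤ C ^ (p.toReal - 1) := mul_le_of_le_one_right' h1

/-- Lemma 1: `‖W(k)‖_{L^p([0,1))} ≤ 2^{1-1/p}` for all `1 ≤ p ≤ ∞`. -/
theorem stmt14 (k : ℕ) (hk : 1 ≤ k) (p : ℝ≥0∞) (hp : 1 ≤ p) :
    eLpNorm (Wfun k) p (volume.restrict (Set.Ico (0 : ℝ) 1)) ≤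
      (2 : ℝ≥0∞) ^ ((1 : ℝ) - p.toReal⁻¹) := by
  exact eLpNorm_le_rpow_of_enorm_le ENNReal.ofNat_ne_top
    (enorm_Wfun_le_two (Nat.one_le_iff_ne_zero.1 hk)) (lintegral_enorm_Wfun_le_one k) hp

end
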